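/- arXiv:1503.09127 — 2 statements merged into one kernel-verified Lean document; each statement's English description precedes it below -/
import Mathlib

section
/- Let f : S² → S² be an orientation preserving homeomorphism. Call a point z ∈ S² free disk recurrent if there exist an integer n > 1 and an open set D ⊆ S² homeomorphic to ℝ² with z ∈ D, fⁿ(z) ∈ D, and f(D) ∩ D = ∅, and write fdrec(f) for the set of free disk recurrent points. Then: (i) fdrec(f) is open and f(fdrec(f)) = fdrec(f); (ii) every point z ∉ fix(f) with z ∈ ω(z) or z ∈ α(z) belongs to fdrec(f); (iii) for every z ∈ S² \ fdrec(f), each of α(z) and ω(z) is contained in a connected subset of fix(f); (iv) if W is a connected component of fdrec(f) with f^q(W) = W for some q ≥ 1, then f(W) = W. -/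
open Filter Metric Set

noncomputable section

/-- The 2-sphere, realized as the unit sphere of `ℝ³`. -/
abbrev S2 : Type := Metric.sphere (0 : EuclideanSpace ℝ (Fin 3)) 1

abbrev R2 : Type := EuclideanSpace ℝ (Fin 2)

/-- `f` is isotopic to the identity: there is a continuous family of homeomorphisms
joining the identity to `f`. -/
def IsotopicToId {X : Type} [TopologicalSpace X] (f : X → X) : Prop :=
  ∃ H : Set.Icc (0 : ℝ) 1 → X → X,
    Continuous (fun p : Set.Icc (0 : ℝ) 1 × X => H p.1 p.2) ∧
    H ⟨0, by norm_num⟩ = id ∧ H ⟨1, by norm_num⟩ = f ∧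
    ∀ t, IsHomeomorph (H t)

/-- The set of free disk recurrent points of `f`: points `z` such that some open
topological disk `D` with `f(D) ∩ D = ∅` contains both `z` and `fⁿ(z)` for some `n > 1`. -/
def fdrec (f : S2 → S2) : Set S2 :=
  {z | ∃ n : ℕ, 1 < n ∧ ∃ D : Set S2, IsOpen D ∧ Nonempty (↥D ≃ₜ R2) ∧
    z ∈ D ∧ f^[n] z ∈ D ∧ f '' D ∩ D = ∅}

/-- The ω-limit set of `z` under `f`. -/
def omegaSet (f : S2 → S2) (z : S2) : Set S2 :=
  ⋂ n : ℕ, closure {y | ∃ k, n ≤ k ∧ f^[k] z = y}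

/-- The α-limit set of `z` under the homeomorphism `f` (ω-limit set for `f⁻¹`). -/
def alphaSet (f : S2 ≃ₜ S2) (z : S2) : Set S2 :=
  ⋂ n : ℕ, closure {y | ∃ k, n ≤ k ∧ (⇑f.symm)^[k] z = y}

open Topology Complex Matrix

/-- There is no nonvanishing section of the square of the tautological bundle over `ℂP¹`. -/
lemma not_nonvanishing_of_degree_two {g₁ g₂ : ℂ → ℂ} (h₁ : Continuous g₁) (h₂ : Continuous g₂)
    (hg₁ : ∀ z, g₁ z ≠ 0) (hg₂ : ∀ z, g₂ z ≠ 0)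
    (h : ∀ z : ℂ, ‖z‖ = 1 → g₁ z = z ^ 2 * g₂ (starRingEnd ℂ z)) : False := by
  have key : ∀ g : ℂ → ℂ, Continuous g → (∀ z, g z ≠ 0) →
      ∃ l : ℂ → ℂ, Continuous l ∧ ∀ z, exp (l z) = g z := by
    intro g hg h0
    obtain ⟨F, ⟨-, hF⟩, -⟩ := isCoveringMapOn_exp.existsUnique_continuousMap_lifts
      (⟨g, hg⟩ : C(ℂ, ℂ)) (a₀ := 0) (e₀ := log (g 0)) (exp_log (h0 0)) (fun a => h0 a)
    exact ⟨F, F.continuous, fun z => congrFun hF z⟩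
  obtain ⟨l₁, hl₁, e₁⟩ := key g₁ h₁ hg₁
  obtain ⟨l₂, hl₂, e₂⟩ := key g₂ h₂ hg₂
  let k : ℝ → ℂ := fun t => l₁ (exp (t * I)) - l₂ (starRingEnd ℂ (exp (t * I))) - 2 * t * I
  have hk : Continuous k := by
    have : Continuous fun t : ℝ => exp (t * I) := by fun_prop
    exact ((hl₁.comp this).sub (hl₂.comp (continuous_conj.comp this))).sub (by fun_prop)
  have hexp : ∀ t, exp (k t) = 1 := by
    intro t
    have hn : ‖exp (t * I)‖ = 1 := norm_exp_ofReal_mul_I t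
    have h3 := h _ hn
    have h4 : exp (2 * t * I) = exp (t * I) ^ 2 := by
      rw [← exp_nat_mul]; congr 1; push_cast; ring
    simp only [k]
    rw [exp_sub, exp_sub, e₁, e₂, h4, h3]
    field_simp [hg₂ _, exp_ne_zero]
  have hre : ∀ t, ∃ n : ℤ, k t = n * (2 * Real.pi * I) := fun t => exp_eq_one_iff.1 (hexp t)
  have hconst : k 0 = k (2 * Real.pi) := by
    choose n hn using hre
    have hc : Continuous n := by
      have h1 : Continuous fun t => (n t : ℝ) := by
        have : (fun t => (n t : ℝ)) = fun t => (k t).im / (2 * Real.pi) := by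
          funext t
          rw [hn t]
          have := Real.pi_pos
          simp
        rw [this]
        exact (continuous_im.comp hk).div_const _
      exact Int.isClosedEmbedding_coe_real.isEmbedding.continuous_iff.2 h1
    rw [hn, hn, PreconnectedSpace.constant inferInstance hc]
  have e0 : exp (((2 * Real.pi : ℝ) : ℂ) * I) = 1 := by
    push_cast; exact exp_two_pi_mul_I
  simp only [k, e0] at hconst
  have := Real.pi_pos
  simp [Complex.ext_iff] at hconst
  linarith

/-- The (doubled) orthogonal projection onto the line in `ℂ²` corresponding to a point of the
sphere under the Hopf correspondence. -/
def hopfMatrix (y : S2) : Matrix (Fin 2) (Fin 2) ℂ :=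
  !![1 + (y.1 2 : ℂ), y.1 0 - y.1 1 * I; y.1 0 + y.1 1 * I, 1 - y.1 2]

/-- The vector `u` lies in the complex line corresponding to `y`. -/
def OnHopfLine (y : S2) (u : Fin 2 → ℂ) : Prop := hopfMatrix y *ᵥ u = (2 : ℂ) • u

/-- The determinant of a pair of vectors in `ℂ²`. -/
def bracket (u v : Fin 2 → ℂ) : ℂ := u 0 * v 1 - u 1 * v 0

lemma S2.sq_sum (y : S2) : y.1 0 ^ 2 + y.1 1 ^ 2 + y.1 2 ^ 2 = 1 := by
  have := EuclideanSpace.norm_sq_eq y.1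
  simp [Fin.sum_univ_three] at this
  exact this.symm

lemma S2.sq_sum_complex (y : S2) : (y.1 0 : ℂ) ^ 2 + (y.1 1 : ℂ) ^ 2 + (y.1 2 : ℂ) ^ 2 = 1 := by
  have := congrArg ofReal (S2.sq_sum y)
  push_cast at this
  exact this

lemma continuous_hopfMatrix : Continuous hopfMatrix := by
  have h : ∀ i : Fin 3, Continuous fun y : S2 => ((y.1 i : ℝ) : ℂ) := fun i =>
    continuous_ofReal.comp (by fun_prop)
  refine continuous_matrix fun i j => ?_
  fin_cases i <;> fin_cases j <;> simp [hopfMatrix] <;> fun_prop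

lemma onHopfLine_iff {y : S2} {u : Fin 2 → ℂ} : OnHopfLine y u ↔
    (y.1 0 - y.1 1 * I) * u 1 = (1 - y.1 2) * u 0 ∧
    (y.1 0 + y.1 1 * I) * u 0 = (1 + y.1 2) * u 1 := by
  rw [OnHopfLine, hopfMatrix, funext_iff, Fin.forall_fin_two]
  simp [Matrix.mulVec, dotProduct, Fin.sum_univ_two]
  refine and_congr ?_ ?_ <;> constructor <;> intro h <;> linear_combination h

lemma onHopfLine_mulVec (y : S2) (u : Fin 2 → ℂ) : OnHopfLine y (hopfMatrix y *ᵥ u) := by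
  rw [onHopfLine_iff, hopfMatrix]
  have h := S2.sq_sum_complex y
  simp [Matrix.mulVec, dotProduct, Fin.sum_univ_two]
  constructor
  · linear_combination (u 0) * h - u 0 * (y.1 1) ^ 2 * I_sq
  · linear_combination (u 1) * h - u 1 * (y.1 1) ^ 2 * I_sq

lemma OnHopfLine.eq {y y' : S2} {u : Fin 2 → ℂ} (h : OnHopfLine y u) (h' : OnHopfLine y' u)
    (hu : u ≠ 0) : y = y' := by
  rw [onHopfLine_iff] at h h'
  obtain ⟨h1, h2⟩ := h
  obtain ⟨h3, h4⟩ := h'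
  set t : Fin 3 → ℂ := fun i => (y'.1 i : ℂ) - y.1 i with ht
  have e1 : (t 0 - t 1 * I) * u 1 = - t 2 * u 0 := by simp only [ht]; linear_combination h3 - h1
  have e2 : (t 0 + t 1 * I) * u 0 = t 2 * u 1 := by simp only [ht]; linear_combination h4 - h2
  have k0 : (t 0 ^ 2 + t 1 ^ 2 + t 2 ^ 2) * u 0 = 0 := by
    linear_combination (t 0 - t 1 * I) * e2 + t 2 * e1 + t 1 ^ 2 * u 0 * I_sq
  have k1 : (t 0 ^ 2 + t 1 ^ 2 + t 2 ^ 2) * u 1 = 0 := by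
    linear_combination (t 0 + t 1 * I) * e1 - t 2 * e2 + t 1 ^ 2 * u 1 * I_sq
  have k : t 0 ^ 2 + t 1 ^ 2 + t 2 ^ 2 = 0 := by
    by_contra hne
    apply hu
    ext i
    fin_cases i
    · simpa [hne] using k0
    · simpa [hne] using k1
  have kr : (y'.1 0 - y.1 0) ^ 2 + (y'.1 1 - y.1 1) ^ 2 + (y'.1 2 - y.1 2) ^ 2 = 0 := by
    simp only [ht] at k
    rw [← ofReal_inj]
    push_cast
    exact k
  apply Subtype.ext
  ext i
  fin_cases i <;> simp <;> nlinarith [sq_nonneg (y'.1 0 - y.1 0), sq_nonneg (y'.1 1 - y.1 1),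
    sq_nonneg (y'.1 2 - y.1 2)]

lemma OnHopfLine.bracket_eq_zero {y : S2} {u v : Fin 2 → ℂ} (h : OnHopfLine y u)
    (h' : OnHopfLine y v) : bracket u v = 0 := by
  rw [onHopfLine_iff] at h h'
  obtain ⟨h1, h2⟩ := h
  obtain ⟨h3, h4⟩ := h'
  have : 2 * bracket u v = 0 := by
    rw [bracket]
    linear_combination -h1 * v 1 + h3 * u 1 + v 0 * h2 - u 0 * h4
  simpa using this

lemma OnHopfLine.eq_of_bracket_eq_zero {y y' : S2} {u a : Fin 2 → ℂ} (h : OnHopfLine y u)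
    (h' : OnHopfLine y' a) (hu : u ≠ 0) (ha : a ≠ 0) (hb : bracket u a = 0) : y = y' := by
  refine h.eq ?_ hu
  rw [bracket] at hb
  rw [onHopfLine_iff] at h' ⊢
  obtain ⟨h3, h4⟩ := h'
  rcases eq_or_ne (a 0) 0 with h0 | h0
  · have h1 : a 1 ≠ 0 := fun h1 => ha (by ext i; fin_cases i <;> simp [h0, h1])
    constructor <;> apply mul_left_cancel₀ h1
    · linear_combination u 1 * h3 - (1 - y'.1 2) * hb
    · linear_combination u 1 * h4 + (y'.1 0 + y'.1 1 * I) * hb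
  · constructor <;> apply mul_left_cancel₀ h0
    · linear_combination u 0 * h3 - (y'.1 0 - y'.1 1 * I) * hb
    · linear_combination u 0 * h4 + (1 + y'.1 2) * hb

lemma exists_onHopfLine (y : S2) : ∃ u, u ≠ 0 ∧ OnHopfLine y u := by
  by_cases h : (1 : ℂ) + y.1 2 = 0
  · refine ⟨hopfMatrix y *ᵥ ![0, 1], fun h0 => ?_, onHopfLine_mulVec _ _⟩
    have := congrFun h0 1
    simp [hopfMatrix, Matrix.mulVec, dotProduct, Fin.sum_univ_two] at this
    have h2 : (2 : ℂ) = 0 := by linear_combination h + this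
    norm_num at h2
  · refine ⟨hopfMatrix y *ᵥ ![1, 0], fun h0 => h ?_, onHopfLine_mulVec _ _⟩
    have := congrFun h0 0
    simpa [hopfMatrix, Matrix.mulVec, dotProduct, Fin.sum_univ_two] using this

lemma OnHopfLine.mulVec_ne_zero {y y' : S2} {u : Fin 2 → ℂ} (h : OnHopfLine y u) (hu : u ≠ 0)
    (hy : y ≠ -y') : hopfMatrix y' *ᵥ u ≠ 0 := by
  intro h0
  refine hy (h.eq ?_ hu)
  have h1 := congrFun h0 0
  have h2 := congrFun h0 1
  simp [hopfMatrix, Matrix.mulVec, dotProduct, Fin.sum_univ_two] at h1 h2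
  rw [onHopfLine_iff]
  simp
  constructor
  · linear_combination -h1
  · linear_combination -h2

lemma exists_hopf_section {u : ℂ → Fin 2 → ℂ} (hu : Continuous u) (h0 : ∀ z, u z ≠ 0) :
    ∃ s : ℂ → S2, Continuous s ∧ ∀ z, OnHopfLine (s z) (u z) := by
  have hN : ∀ z, normSq (u z 0) + normSq (u z 1) ≠ 0 := by
    intro z hz
    have h1 : normSq (u z 0) = 0 := by
      linarith [normSq_nonneg (u z 0), normSq_nonneg (u z 1)]
    have h2 : normSq (u z 1) = 0 := by
      linarith [normSq_nonneg (u z 0), normSq_nonneg (u z 1)]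
    exact h0 z (by ext i; fin_cases i; exacts [normSq_eq_zero.1 h1, normSq_eq_zero.1 h2])
  let N : ℂ → ℝ := fun z => normSq (u z 0) + normSq (u z 1)
  let c : ℂ → ℂ := fun z => starRingEnd ℂ (u z 0) * u z 1
  let s : ℂ → EuclideanSpace ℝ (Fin 3) := fun z =>
    !₂[2 * (c z).re / N z, 2 * (c z).im / N z, (normSq (u z 0) - normSq (u z 1)) / N z]
  have hs : ∀ z, s z ∈ Metric.sphere (0 : EuclideanSpace ℝ (Fin 3)) 1 := by
    intro z
    rw [mem_sphere_zero_iff_norm, ← sq_eq_sq₀ (norm_nonneg _) zero_le_one,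
      EuclideanSpace.norm_sq_eq]
    have := hN z
    simp only [Fin.sum_univ_three, s, c, N]
    simp
    field_simp
    simp only [sq_abs, normSq_apply]
    ring
  refine ⟨fun z => ⟨s z, hs z⟩, ?_, fun z => ?_⟩
  · have hu0 : Continuous fun z => u z 0 := (continuous_apply 0).comp hu
    have hu1 : Continuous fun z => u z 1 := (continuous_apply 1).comp hu
    have n0 := continuous_normSq.comp hu0
    have n1 := continuous_normSq.comp hu1
    have hNc : Continuous N := n0.add n1
    have hc : Continuous c := (continuous_conj.comp hu0).mul hu1
    refine Continuous.subtype_mk ?_ _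
    refine (PiLp.continuous_toLp 2 _).comp (continuous_pi fun i => ?_)
    fin_cases i
    · exact ((continuous_re.comp hc).const_mul 2).div hNc hN
    · exact ((continuous_im.comp hc).const_mul 2).div hNc hN
    · exact (n0.sub n1).div hNc hN
  · rw [onHopfLine_iff]
    have hNz : (N z : ℂ) ≠ 0 := by exact_mod_cast hN z
    have e1 : (((s z) 0 : ℝ) : ℂ) + ((s z) 1 : ℝ) * I = 2 * c z / N z := by
      simp [s]
      conv_rhs => rw [← re_add_im (c z)]
      ring
    have e2 : (((s z) 0 : ℝ) : ℂ) - ((s z) 1 : ℝ) * I = 2 * starRingEnd ℂ (c z) / N z := by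
      have := congrArg (starRingEnd ℂ) e1
      simpa [sub_eq_add_neg, map_ofNat] using this
    have e3 : (((s z) 2 : ℝ) : ℂ) = (u z 0 * starRingEnd ℂ (u z 0)
        - u z 1 * starRingEnd ℂ (u z 1)) / N z := by
      simp [s, mul_conj]
    have e4 : (N z : ℂ) = u z 0 * starRingEnd ℂ (u z 0) + u z 1 * starRingEnd ℂ (u z 1) := by
      simp [N, mul_conj]
    simp only [e1, e2, e3]
    constructor
    · field_simp
      rw [e4]
      simp [c]
      ring
    · field_simp
      rw [e4]
      simp [c]
      ring

lemma bracket_smul_smul (c d : ℂ) (u v : Fin 2 → ℂ) :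
    bracket (c • u) (d • v) = c * d * bracket u v := by
  simp [bracket]
  ring

/-- A bundle map from the tautological line bundle to its pullback under `f` exists when `f` is
isotopic to the identity. -/
lemma IsotopicToId.exists_bundle_map {f : S2 → S2} (hf : IsotopicToId f) :
    ∃ Φ : S2 → Matrix (Fin 2) (Fin 2) ℂ, Continuous Φ ∧
      ∀ x u, OnHopfLine x u → u ≠ 0 → OnHopfLine (f x) (Φ x *ᵥ u) ∧ Φ x *ᵥ u ≠ 0 := by
  obtain ⟨H, hH, h0, h1, -⟩ := hf
  let P : Icc (0 : ℝ) 1 → Prop := fun t =>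
    ∃ Φ : S2 → Matrix (Fin 2) (Fin 2) ℂ, Continuous Φ ∧
      ∀ x u, OnHopfLine x u → u ≠ 0 → OnHopfLine (H t x) (Φ x *ᵥ u) ∧ Φ x *ᵥ u ≠ 0
  have step : ∀ t t', (∀ x, H t x ≠ -H t' x) → P t → P t' := by
    rintro t t' htt ⟨Φ, hΦ, h⟩
    refine ⟨fun x => hopfMatrix (H t' x) * Φ x, ?_, fun x u hx hu => ?_⟩
    · have hc : Continuous (H t') :=
        hH.comp (continuous_const.prodMk continuous_id : Continuous fun x : S2 => (t', x))
      exact (continuous_hopfMatrix.comp hc).matrix_mul hΦ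
    · obtain ⟨h2, h3⟩ := h x u hx hu
      simp only [← Matrix.mulVec_mulVec]
      exact ⟨onHopfLine_mulVec _ _, h2.mulVec_ne_zero h3 (htt x)⟩
  have near : ∀ t, ∀ᶠ t' in 𝓝 t, ∀ x, H t x ≠ -H t' x := by
    intro t
    have := isCompact_univ.eventually_forall_of_forall_eventually (x₀ := t) (K := (univ : Set S2))
      (P := fun t' x => H t x ≠ -H t' x) (fun x _ => by
        have c1 : Continuous fun p : Icc (0 : ℝ) 1 × S2 => H t p.2 :=
          hH.comp (continuous_const.prodMk continuous_snd :
            Continuous fun p : Icc (0 : ℝ) 1 × S2 => (t, p.2))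
        have c2 : Continuous fun p : Icc (0 : ℝ) 1 × S2 => -H p.1 p.2 := continuous_neg.comp hH
        exact (isOpen_ne_fun c1 c2).mem_nhds (ne_neg_of_mem_unit_sphere ℝ (H t x)))
    simpa using this
  have hclopen : IsClopen {t | P t} := by
    constructor
    · rw [← isOpen_compl_iff, isOpen_iff_mem_nhds]
      intro t ht
      filter_upwards [near t] with t' ht' h
      exact ht (step t' t (fun x hx => ht' x (by rw [hx, neg_neg])) h)
    · rw [isOpen_iff_mem_nhds]
      intro t ht
      filter_upwards [near t] with t' ht'
      exact step t t' ht' ht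
  have h0P : P ⟨0, by norm_num⟩ :=
    ⟨fun _ => 1, continuous_const, fun x u hx hu => by
      rw [h0, Matrix.one_mulVec]
      exact ⟨hx, hu⟩⟩
  have h1P : P ⟨1, by norm_num⟩ := by
    have hmem : (⟨1, by norm_num⟩ : Icc (0 : ℝ) 1) ∈ {t | P t} := by
      rw [hclopen.eq_univ ⟨_, h0P⟩]
      trivial
    exact hmem
  simp only [P, h1] at h1P
  exact h1P

/-- A homeomorphism of the sphere isotopic to the identity cannot map an open set off itself
while fixing its frontier pointwise. -/
lemma IsotopicToId.not_disjoint_image_of_frontier_fixed {f : S2 ≃ₜ S2} (hf : IsotopicToId f)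
    {W : Set S2} (hne : W.Nonempty) (hfix : ∀ x ∈ frontier W, f x = x) :
    ¬ Disjoint W (f '' W) := by
  classical
  intro hdisj
  obtain ⟨Φ, hΦ, hΦl⟩ := hf.exists_bundle_map
  obtain ⟨a', ha'⟩ := hne
  obtain ⟨a, ha0, ha⟩ := exists_onHopfLine a'
  obtain ⟨b, hb0, hb⟩ := exists_onHopfLine (f a')
  let G : S2 → (Fin 2 → ℂ) → ℂ := fun x v =>
    if x ∈ W then bracket v b * bracket (Φ x *ᵥ v) a else bracket v a * bracket (Φ x *ᵥ v) b
  have hG0 : ∀ x v, OnHopfLine x v → v ≠ 0 → G x v ≠ 0 := by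
    intro x v hx hv
    obtain ⟨h1, h2⟩ := hΦl x v hx hv
    by_cases hxW : x ∈ W
    · simp only [G, if_pos hxW]
      refine mul_ne_zero (fun h => ?_) (fun h => ?_)
      · have := hx.eq_of_bracket_eq_zero hb hv hb0 h
        exact hdisj.le_bot ⟨hxW, a', ha', this.symm⟩
      · have := h1.eq_of_bracket_eq_zero ha h2 ha0 h
        exact hdisj.le_bot ⟨ha', x, hxW, this⟩
    · simp only [G, if_neg hxW]
      refine mul_ne_zero (fun h => ?_) (fun h => ?_)
      · exact hxW (hx.eq_of_bracket_eq_zero ha hv ha0 h ▸ ha')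
      · exact hxW (f.injective (h1.eq_of_bracket_eq_zero hb h2 hb0 h) ▸ ha')
  have hGs : ∀ x (c : ℂ) v, G x (c • v) = c ^ 2 * G x v := by
    intro x c v
    have e : ∀ w, bracket (c • v) w = c * bracket v w := fun w => by
      simpa using bracket_smul_smul c 1 v w
    have e' : ∀ w, bracket (c • Φ x *ᵥ v) w = c * bracket (Φ x *ᵥ v) w := fun w => by
      simpa using bracket_smul_smul c 1 (Φ x *ᵥ v) w
    simp only [G, Matrix.mulVec_smul, e, e']
    split_ifs <;> ring
  have hGc : ∀ (s : ℂ → S2) (u : ℂ → Fin 2 → ℂ), Continuous s → Continuous u →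
      (∀ z, OnHopfLine (s z) (u z)) → (∀ z, u z ≠ 0) → Continuous fun z => G (s z) (u z) := by
    intro s u hs hu hsu hu0
    have hbr : ∀ (w : ℂ → Fin 2 → ℂ) (d : Fin 2 → ℂ), Continuous w →
        Continuous fun z => bracket (w z) d := by
      intro w d hw
      have h0 : Continuous fun z => w z 0 := (continuous_apply 0).comp hw
      have h1 : Continuous fun z => w z 1 := (continuous_apply 1).comp hw
      simp only [bracket]
      fun_prop
    have hΦu : Continuous fun z => Φ (s z) *ᵥ u z := (hΦ.comp hs).matrix_mulVec hu
    refine Continuous.if (fun z hz => ?_) ((hbr _ _ hu).mul (hbr _ _ hΦu))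
      ((hbr _ _ hu).mul (hbr _ _ hΦu))
    have hfr : s z ∈ frontier W := hs.frontier_preimage_subset W hz
    have h1 := (hΦl _ _ (hsu z) (hu0 z)).1
    rw [hfix _ hfr] at h1
    have h2 := (hsu z).bracket_eq_zero h1
    generalize Φ (s z) *ᵥ u z = w at h2 ⊢
    simp only [bracket] at h2 ⊢
    linear_combination (a 1 * b 0 - a 0 * b 1) * h2
  have hu₁ : Continuous fun z : ℂ => ![z, 1] := by fun_prop
  have hu₂ : Continuous fun z : ℂ => ![1, z] := by fun_prop
  have hn₁ : ∀ z : ℂ, ![z, 1] ≠ 0 := fun z h => by simpa using congrFun h 1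
  have hn₂ : ∀ z : ℂ, ![1, z] ≠ 0 := fun z h => by simpa using congrFun h 0
  obtain ⟨s₁, hs₁, hl₁⟩ := exists_hopf_section hu₁ hn₁
  obtain ⟨s₂, hs₂, hl₂⟩ := exists_hopf_section hu₂ hn₂
  refine not_nonvanishing_of_degree_two (hGc _ _ hs₁ hu₁ hl₁ hn₁) (hGc _ _ hs₂ hu₂ hl₂ hn₂)
    (fun z => hG0 _ _ (hl₁ z) (hn₁ z)) (fun z => hG0 _ _ (hl₂ z) (hn₂ z)) fun z hz => ?_
  have hzz : z * starRingEnd ℂ z = 1 := by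
    rw [mul_conj, normSq_eq_norm_sq, hz]; simp
  have hv : ![z, 1] = z • ![1, starRingEnd ℂ z] := by
    ext i; fin_cases i <;> simp [hzz]
  have hz0 : z ≠ 0 := fun h => by simp [h] at hz
  have hs : s₁ z = s₂ (starRingEnd ℂ z) := by
    refine (hl₁ z).eq ?_ (hn₁ z)
    have := hl₂ (starRingEnd ℂ z)
    rw [hv, OnHopfLine, Matrix.mulVec_smul, this, smul_comm]
  rw [hs, hv, hGs]

/-- The centre of a ball in the plane can be moved to any point of the ball by a homeomorphism
supported in the ball. -/
lemma exists_homeomorph_supported_in_ball {c y : R2} {r : ℝ} (hy : y ∈ ball c r) :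
    ∃ φ : R2 ≃ₜ R2, φ c = y ∧ ∀ x ∉ ball c r, φ x = x := by
  have hr : 0 < r := pos_of_mem_ball hy
  let ρ : R2 → ℝ := fun x => max (1 - dist x c / r) 0
  let φ : R2 → R2 := fun x => x + ρ x • (y - c)
  have hk : dist y c / r < 1 := (div_lt_one hr).2 hy
  let k : NNReal := ⟨dist y c / r, by positivity⟩
  have hρ : ∀ x x', |ρ x - ρ x'| ≤ dist x x' / r := by
    intro x x'
    refine (abs_max_sub_max_le_abs (1 - dist x c / r) (1 - dist x' c / r) 0).trans ?_
    rw [show 1 - dist x c / r - (1 - dist x' c / r) = -((dist x c - dist x' c) / r) by ring,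
      abs_neg, abs_div, abs_of_pos hr]
    gcongr
    exact abs_dist_sub_le x x' c
  have happ : ApproximatesLinearOn φ ((ContinuousLinearEquiv.refl ℝ R2 : R2 ≃L[ℝ] R2) : R2 →L[ℝ] R2)
      univ k := by
    intro x _ x' _
    have : φ x - φ x' - (ContinuousLinearEquiv.refl ℝ R2 : R2 →L[ℝ] R2) (x - x')
        = (ρ x - ρ x') • (y - c) := by
      simp [φ, sub_smul]
      abel
    rw [this, norm_smul, Real.norm_eq_abs, ← dist_eq_norm, ← dist_eq_norm]
    calc |ρ x - ρ x'| * dist y c ≤ dist x x' / r * dist y c := by gcongr; exact hρ x x'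
      _ = dist y c / r * dist x x' := by ring
  refine ⟨happ.toHomeomorph φ (Or.inr ?_), ?_, fun x hx => ?_⟩
  · have : ‖((ContinuousLinearEquiv.refl ℝ R2).symm : R2 →L[ℝ] R2)‖₊ = 1 := by
      simp
    rw [this, inv_one]
    exact hk
  · change φ c = y
    simp [φ, ρ]
  · change φ x = x
    have : r ≤ dist x c := by simpa using hx
    have : 1 ≤ dist x c / r := (one_le_div hr).2 this
    simp [φ, ρ, this]

lemma nonempty_homeomorph_ball {c : R2} {r : ℝ} (hr : 0 < r) : Nonempty (ball c r ≃ₜ R2) := by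
  have e := (OpenPartialHomeomorph.univBall (E := R2) c r).toHomeomorphSourceTarget
  rw [OpenPartialHomeomorph.univBall_source, OpenPartialHomeomorph.univBall_target c hr] at e
  exact ⟨e.symm.trans (Homeomorph.Set.univ _)⟩

/-- Two points of a connected subset of an open set in the plane lie in a common open disk. -/
lemma exists_disk_plane {U K : Set R2} (hU : IsOpen U) (hK : IsPreconnected K) (hKU : K ⊆ U)
    {a b : R2} (ha : a ∈ K) (hb : b ∈ K) :
    ∃ D, IsOpen D ∧ Nonempty (D ≃ₜ R2) ∧ a ∈ D ∧ b ∈ D ∧ D ⊆ U := by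
  let R : R2 → Prop := fun b => ∃ D, IsOpen D ∧ Nonempty (D ≃ₜ R2) ∧ a ∈ D ∧ b ∈ D ∧ D ⊆ U
  have haR : R a := by
    obtain ⟨r, hr, hrU⟩ := Metric.isOpen_iff.1 hU a (hKU ha)
    exact ⟨ball a r, isOpen_ball, nonempty_homeomorph_ball hr, mem_ball_self hr,
      mem_ball_self hr, hrU⟩
  have hloc : ∀ c ∈ K, ∀ᶠ y in 𝓝[K] c, R c ↔ R y := by
    intro c hc
    have h1 : ∀ᶠ y in 𝓝[K] c, R c → R y := by
      by_cases hcR : R c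
      · obtain ⟨D, hD, hD', haD, hcD, hDU⟩ := hcR
        filter_upwards [mem_nhdsWithin_of_mem_nhds (hD.mem_nhds hcD)] with y hy _
        exact ⟨D, hD, hD', haD, hy, hDU⟩
      · exact Eventually.of_forall fun y h => absurd h hcR
    have h2 : ∀ᶠ y in 𝓝[K] c, R y → R c := by
      rcases eq_or_ne c a with rfl | hca
      · exact Eventually.of_forall fun _ _ => haR
      · obtain ⟨r, hr, hrU⟩ := Metric.isOpen_iff.1 (hU.inter isOpen_ne) c ⟨hKU hc, hca⟩
        filter_upwards [mem_nhdsWithin_of_mem_nhds (ball_mem_nhds c hr)] with y hy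
        rintro ⟨D, hD, ⟨e⟩, haD, hyD, hDU⟩
        obtain ⟨φ, hφ, hφ'⟩ := exists_homeomorph_supported_in_ball hy
        have hsupp : ∀ x, φ x ∈ D → x ∈ U := fun x hx => by
          by_cases hxb : x ∈ ball c r
          · exact (hrU hxb).1
          · exact hDU (hφ' x hxb ▸ hx)
        refine ⟨φ ⁻¹' D, hD.preimage φ.continuous, ⟨(Homeomorph.sets φ rfl).trans e⟩, ?_, ?_,
          hsupp⟩
        · have : a ∉ ball c r := fun h => (hrU h).2 rfl
          simpa [hφ' a this] using haD
        · simpa [hφ] using hyD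
    filter_upwards [h1, h2] with y h1 h2 using ⟨h1, h2⟩
  exact (hK.induction₂ (fun x y => R x ↔ R y) hloc (fun _ _ _ _ _ _ => Iff.trans)
    (fun _ _ _ _ => Iff.symm) ha hb).1 haR

lemma S2.exists_chart (p : S2) : ∃ g : R2 → S2, IsOpenEmbedding g ∧ range g = {p}ᶜ := by
  have := Fact.mk (@finrank_euclideanSpace_fin ℝ _ (2 + 1))
  let e := (stereographic' 2 p).symm
  have hs : e.source = univ := stereographic'_target p
  refine ⟨e, e.isOpenEmbedding hs, ?_⟩
  rw [← image_univ, ← hs, e.image_source_eq_target]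
  exact stereographic'_source p

/-- Two points of a connected subset of a proper open set in the sphere lie in a common open
disk. -/
lemma S2.exists_disk {U K : Set S2} (hU : IsOpen U) (hU' : U ≠ univ) (hK : IsPreconnected K)
    (hKU : K ⊆ U) {a b : S2} (ha : a ∈ K) (hb : b ∈ K) :
    ∃ D, IsOpen D ∧ Nonempty (D ≃ₜ R2) ∧ a ∈ D ∧ b ∈ D ∧ D ⊆ U := by
  obtain ⟨p, hp⟩ := (ne_univ_iff_exists_notMem U).1 hU'
  obtain ⟨g, hg, hgr⟩ := S2.exists_chart p
  have hUg : U ⊆ range g := by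
    rw [hgr]
    rintro x hx rfl
    exact hp hx
  obtain ⟨a, rfl⟩ := hUg (hKU ha)
  obtain ⟨b, rfl⟩ := hUg (hKU hb)
  obtain ⟨D, hD, ⟨e⟩, haD, hbD, hDU⟩ := exists_disk_plane (hU.preimage hg.continuous)
    (hK.preimage_of_isOpenMap hg.injective hg.isOpenMap (hKU.trans hUg))
    (preimage_mono hKU) (a := a) (b := b) ha hb
  exact ⟨g '' D, hg.isOpenMap _ hD, ⟨(hg.isEmbedding.homeomorphImage D).symm.trans e⟩,
    mem_image_of_mem _ haD, mem_image_of_mem _ hbD, image_subset_iff.2 hDU⟩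

/-- Two points of a free continuum lie in a common free open disk. -/
lemma exists_free_disk (f : S2 ≃ₜ S2) {K : Set S2} (hKc : IsCompact K) (hK : IsPreconnected K)
    (hf : Disjoint K (f '' K)) {a b : S2} (ha : a ∈ K) (hb : b ∈ K) :
    ∃ D, IsOpen D ∧ Nonempty (D ≃ₜ R2) ∧ a ∈ D ∧ b ∈ D ∧ f '' D ∩ D = ∅ := by
  obtain ⟨U, V, hU, hV, hKU, hKV, hUV⟩ :=
    SeparatedNhds.of_isCompact_isCompact hKc (hKc.image f.continuous) hf
  have hfree : ∀ x ∈ U ∩ f ⁻¹' V, f x ∉ U ∩ f ⁻¹' V := fun x hx hx' =>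
    hUV.le_bot ⟨hx'.1, hx.2⟩
  have hKU' : K ⊆ U ∩ f ⁻¹' V := fun x hx => ⟨hKU hx, hKV (mem_image_of_mem _ hx)⟩
  obtain ⟨D, hD, hD', haD, hbD, hDU⟩ := S2.exists_disk
    (hU.inter (hV.preimage f.continuous)) ((ne_univ_iff_exists_notMem _).2
    ⟨f a, hfree a (hKU' ha)⟩) hK hKU' ha hb
  refine ⟨D, hD, hD', haD, hbD, ?_⟩
  rw [eq_empty_iff_forall_notMem]
  rintro _ ⟨⟨x, hx, rfl⟩, hx'⟩
  exact hfree x (hDU hx) (hDU hx')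

lemma exists_free_disk_of_ne (f : S2 ≃ₜ S2) {z : S2} (hz : f z ≠ z) :
    ∃ D, IsOpen D ∧ Nonempty (D ≃ₜ R2) ∧ z ∈ D ∧ f '' D ∩ D = ∅ := by
  obtain ⟨D, h1, h2, h3, -, h4⟩ := exists_free_disk f isCompact_singleton
    isPreconnected_singleton (by simpa using hz.symm) (mem_singleton z) (mem_singleton z)
  exact ⟨D, h1, h2, h3, h4⟩

lemma isOpen_fdrec (f : S2 ≃ₜ S2) : IsOpen (fdrec f) := by
  rw [isOpen_iff_mem_nhds]
  rintro z ⟨n, hn, D, hD, hD', hz, hfz, hfree⟩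
  filter_upwards [hD.mem_nhds hz, (hD.preimage (f.continuous.iterate n)).mem_nhds hfz] with w hw hw'
  exact ⟨n, hn, D, hD, hD', hw, hw', hfree⟩

/-- Free disk recurrence is invariant under a homeomorphism commuting with `f`. -/
lemma mem_fdrec_of_commute {f g : S2 ≃ₜ S2} (h : Function.Commute f g) {z : S2}
    (hz : z ∈ fdrec f) : g z ∈ fdrec f := by
  obtain ⟨n, hn, D, hD, ⟨e⟩, hz, hfz, hfree⟩ := hz
  refine ⟨n, hn, g '' D, g.isOpenMap D hD, ⟨(g.image D).symm.trans e⟩, mem_image_of_mem _ hz,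
    ⟨_, hfz, ((h.iterate_left n) z).symm⟩, ?_⟩
  rw [eq_empty_iff_forall_notMem] at hfree ⊢
  rintro _ ⟨⟨_, ⟨x, hx, rfl⟩, rfl⟩, y, hy, hxy⟩
  have : y = f x := g.injective (hxy.trans (h x))
  exact hfree y ⟨⟨x, hx, this.symm⟩, hy⟩

lemma apply_mem_fdrec_iff (f : S2 ≃ₜ S2) {z : S2} : f z ∈ fdrec f ↔ z ∈ fdrec f := by
  refine ⟨fun h => ?_, mem_fdrec_of_commute (Function.Commute.refl f)⟩
  have := mem_fdrec_of_commute (f := f) (g := f.symm) (fun x => by simp) h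
  simpa using this

lemma iterate_mem_fdrec_iff (f : S2 ≃ₜ S2) (n : ℕ) {z : S2} :
    f^[n] z ∈ fdrec f ↔ z ∈ fdrec f := by
  induction n with
  | zero => rfl
  | succ n ih => rw [Function.iterate_succ_apply', apply_mem_fdrec_iff, ih]

lemma image_fdrec (f : S2 ≃ₜ S2) : f '' fdrec f = fdrec f := by
  ext z
  rw [f.image_eq_preimage_symm, mem_preimage, ← apply_mem_fdrec_iff, f.apply_symm_apply]

lemma fdrec_symm_subset (f : S2 ≃ₜ S2) : fdrec f.symm ⊆ fdrec f := by
  rintro z ⟨n, hn, D, hD, hD', hz, hfz, hfree⟩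
  have hw : f^[n] (f.symm^[n] z) = z := Function.LeftInverse.iterate f.apply_symm_apply n z
  rw [← hw, iterate_mem_fdrec_iff]
  refine ⟨n, hn, D, hD, hD', hfz, hw.symm ▸ hz, ?_⟩
  rw [eq_empty_iff_forall_notMem] at hfree ⊢
  rintro _ ⟨⟨x, hx, rfl⟩, hfx⟩
  exact hfree x ⟨⟨f x, hfx, f.symm_apply_apply x⟩, hx⟩

/-- A point whose orbit returns to a small neighbourhood of a non-fixed point is free disk
recurrent. -/
lemma mem_fdrec_of_mem_omegaSet (f : S2 ≃ₜ S2) {x z : S2} (hx : f x ≠ x)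
    (hxz : x ∈ omegaSet f z) : z ∈ fdrec f := by
  obtain ⟨D, hD, hD', hxD, hfree⟩ := exists_free_disk_of_ne f hx
  have hret : ∀ n, ∃ k, n ≤ k ∧ f^[k] z ∈ D := by
    intro n
    obtain ⟨_, hy, k, hk, rfl⟩ := mem_closure_iff.1 (mem_iInter.1 hxz n) D hD hxD
    exact ⟨k, hk, hy⟩
  obtain ⟨k, -, hk⟩ := hret 0
  obtain ⟨m, hm, hmD⟩ := hret (k + 2)
  rw [← iterate_mem_fdrec_iff f k]
  refine ⟨m - k, by omega, D, hD, hD', hk, ?_, hfree⟩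
  rwa [← Function.iterate_add_apply, Nat.sub_add_cancel (by omega)]

lemma omegaSet_isConnected (f : S2 ≃ₜ S2) {z : S2} (hfix : ∀ x ∈ omegaSet f z, f x = x) :
    IsConnected (omegaSet f z) := by
  let S : ℕ → Set S2 := fun n => closure {y | ∃ k, n ≤ k ∧ f^[k] z = y}
  have hSc : ∀ n, IsCompact (S n) := fun n => isClosed_closure.isCompact
  have hSm : ∀ m n, m ≤ n → S n ⊆ S m := fun m n h =>
    closure_mono fun y ⟨k, hk, e⟩ => ⟨k, h.trans hk, e⟩
  have hzS : ∀ n k, n ≤ k → f^[k] z ∈ S n := fun n k h => subset_closure ⟨k, h, rfl⟩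
  have hω : IsClosed (omegaSet f z) := isClosed_iInter fun n => isClosed_closure
  refine ⟨IsCompact.nonempty_iInter_of_sequence_nonempty_isCompact_isClosed S
    (fun n => hSm _ _ n.le_succ) (fun n => ⟨_, hzS n n le_rfl⟩) (hSc 0)
    fun n => isClosed_closure, ?_⟩
  rw [isPreconnected_iff_subset_of_fully_disjoint_closed hω]
  intro A B hA hB hAB hdisj
  obtain ⟨U, V, hU, hV, hAU, hBV, hUV⟩ :=
    SeparatedNhds.of_isCompact_isCompact hA.isCompact hB.isCompact hdisj
  let U' := U ∩ f ⁻¹' U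
  let V' := V ∩ f ⁻¹' V
  have hU' : IsOpen U' := hU.inter (hU.preimage f.continuous)
  have hV' : IsOpen V' := hV.inter (hV.preimage f.continuous)
  have hsub : omegaSet f z ⊆ U' ∪ V' := by
    intro x hx
    have hfx := hfix x hx
    rcases hAB hx with h | h
    · exact Or.inl ⟨hAU h, by rw [mem_preimage, hfx]; exact hAU h⟩
    · exact Or.inr ⟨hBV h, by rw [mem_preimage, hfx]; exact hBV h⟩
  obtain ⟨n, hn⟩ := exists_subset_nhds_of_isCompact (V := S)
    (directed_of_isDirected_le fun m n h => hSm m n h) hSc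
    (fun x hx => (hU'.union hV').mem_nhds (hsub hx))
  have hstay : ∀ (O P : Set S2), Disjoint O P → f^[n] z ∈ O ∩ f ⁻¹' O →
      S n ⊆ (O ∩ f ⁻¹' O) ∪ (P ∩ f ⁻¹' P) → ∀ k, n ≤ k → f^[k] z ∈ O ∩ f ⁻¹' O := by
    intro O P hOP h0 hS k hk
    induction k, hk using Nat.le_induction with
    | base => exact h0
    | succ k hk ih =>
      have h1 : f^[k + 1] z ∈ O := by
        rw [Function.iterate_succ_apply']
        exact ih.2
      exact (hS (hzS n (k + 1) (by omega))).resolve_right fun h => hOP.le_bot ⟨h1, h.1⟩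
  have hcl : ∀ (O P : Set S2), IsOpen P → Disjoint O P → (∀ k, n ≤ k → f^[k] z ∈ O) →
      Disjoint (omegaSet f z) P := by
    intro O P hP hOP h
    have : S n ⊆ closure O := closure_mono (by rintro _ ⟨k, hk, rfl⟩; exact h k hk)
    exact ((hOP.closure_left hP).mono_left this).mono_left (iInter_subset _ n)
  rcases hn (hzS n n le_rfl) with h | h
  · have h1 := hcl U V hV hUV fun k hk => (hstay U V hUV h hn k hk).1
    exact Or.inl fun x hx => (hAB hx).resolve_right fun h => h1.le_bot ⟨hx, hBV h⟩
  · have h1 := hcl V U hU hUV.symm fun k hk =>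
      (hstay V U hUV.symm h (by rwa [union_comm]) k hk).1
    exact Or.inr fun x hx => (hAB hx).resolve_left fun h => h1.le_bot ⟨hx, hAU h⟩

lemma mem_fdrec_of_iterate_eq (f : S2 ≃ₜ S2) {z : S2} (hz : f z ≠ z) {n : ℕ} (hn : 0 < n)
    (h : f^[n] z = z) : z ∈ fdrec f := by
  refine mem_fdrec_of_mem_omegaSet f hz (mem_iInter.2 fun m => subset_closure ⟨n * m, ?_, ?_⟩)
  · exact Nat.le_mul_of_pos_left m hn
  · rw [Function.iterate_mul]
    exact Function.iterate_fixed h m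

/-- A wandering periodic open connected set of free disk recurrent points, whose frontier
consists of points that are not free disk recurrent, has its frontier fixed pointwise. -/
lemma frontier_fixed_of_disjoint_image (f : S2 ≃ₜ S2) {W : Set S2} (hWo : IsOpen W)
    (hWc : IsConnected W) (hWF : W ⊆ fdrec f) (hfr : ∀ x ∈ frontier W, x ∉ fdrec f)
    (hd : Disjoint W (f '' W)) {q : ℕ} (hq : 1 < q) (hfq : f^[q] '' W = W) :
    ∀ x ∈ frontier W, f x = x := by
  by_contra! hcon
  obtain ⟨z₀, hz₀, hfz₀⟩ := hcon
  obtain ⟨w, hw⟩ := hWc.nonempty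
  obtain ⟨g, hg, hgr⟩ := S2.exists_chart (f w)
  have hclr : closure W ⊆ range g := by
    rw [hgr]
    rintro x hx rfl
    exact (hd.closure_left (f.isOpenMap W hWo)).le_bot ⟨hx, w, hw, rfl⟩
  have hcl : ∀ y, g y ∈ closure W ↔ y ∈ closure (g ⁻¹' W) := fun y => by
    rw [← hg.isOpenMap.preimage_closure_eq_closure_preimage hg.continuous, mem_preimage]
  have hW'o : IsOpen (g ⁻¹' W) := hWo.preimage hg.continuous
  obtain ⟨y₀, rfl⟩ := hclr hz₀.1
  have hy₀W : g y₀ ∉ W := fun h => (disjoint_frontier_iff_isOpen.2 hWo).le_bot ⟨hz₀, h⟩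
  have hnf : IsOpen {y | f (g y) ≠ g y} :=
    isOpen_ne_fun (f.continuous.comp hg.continuous) hg.continuous
  obtain ⟨ε, hε, hεf⟩ := Metric.isOpen_iff.1 hnf y₀ hfz₀
  obtain ⟨x, hxW, hxy₀⟩ := Metric.mem_closure_iff.1 ((hcl y₀).1 hz₀.1) (ε / 2) (half_pos hε)
  obtain ⟨y, hyW, hy⟩ := hW'o.isClosed_compl.exists_infDist_eq_dist ⟨y₀, hy₀W⟩ x
  have hxy : dist x y ≤ dist x y₀ := hy ▸ infDist_le_dist_of_mem hy₀W
  have hball : ∀ t, dist x t < dist x y → g t ∈ W := by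
    intro t ht
    by_contra hcon
    have : infDist x (g ⁻¹' W)ᶜ ≤ dist x t := infDist_le_dist_of_mem hcon
    linarith
  have hpos : 0 < dist x y := dist_pos.2 fun h => hyW (h ▸ hxW)
  have hyfix : f (g y) ≠ g y := hεf <| by
    rw [mem_ball]
    linarith [dist_triangle y x y₀, dist_comm x y, dist_comm y₀ x]
  have hycl : g y ∈ closure W := by
    rw [hcl]
    refine closure_mono (s := ball x (dist x y)) (fun t ht => hball t ?_) ?_
    · rwa [dist_comm]
    · rw [closure_ball x hpos.ne', mem_closedBall, dist_comm]
  have hyF : g y ∉ fdrec f := hfr _ ⟨hycl, fun h => hyW (show g y ∈ W from interior_subset h)⟩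
  have hseg : ∀ t ∈ segment ℝ x y, g t ∈ W ∨ g t = g y := by
    rintro t ht
    rw [segment_eq_image_lineMap] at ht
    obtain ⟨s, ⟨hs0, hs1⟩, rfl⟩ := ht
    rcases hs1.eq_or_lt with rfl | hs1
    · right; simp
    · left
      apply hball
      rw [dist_left_lineMap, Real.norm_of_nonneg hs0]
      nlinarith
  let γ := g '' segment ℝ x y
  have hγc : IsCompact γ := by
    refine IsCompact.image ?_ hg.continuous
    rw [segment_eq_image_lineMap]
    exact isCompact_Icc.image (by fun_prop)
  have hγp : IsPreconnected γ :=
    (convex_segment x y).isPreconnected.image _ hg.continuous.continuousOn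
  have hfqc : Continuous f^[q] := f.continuous.iterate q
  have hfqW : ∀ v ∈ W, f^[q] v ∈ W := fun v hv => hfq ▸ mem_image_of_mem _ hv
  have : LocallyPathConnectedSpace S2 := ChartedSpace.locallyPathConnectedSpace R2 S2
  obtain ⟨p, hp⟩ := (hWo.isConnected_iff_isPathConnected.1 hWc).joinedIn _ hxW _ (hfqW _ hxW)
  have hxγ : g x ∈ γ := mem_image_of_mem _ (left_mem_segment ℝ x y)
  have hyγ : g y ∈ γ := mem_image_of_mem _ (right_mem_segment ℝ x y)
  let K := (γ ∪ range p) ∪ f^[q] '' γ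
  have hKc : IsCompact K :=
    (hγc.union (isCompact_range p.continuous)).union (hγc.image hfqc)
  have hKp : IsPreconnected K := by
    refine IsPreconnected.union (f^[q] (g x)) (Or.inr ⟨1, p.target⟩) (mem_image_of_mem _ hxγ)
      (IsPreconnected.union (g x) hxγ ⟨0, p.source⟩ hγp (isPreconnected_range p.continuous))
      (hγp.image _ hfqc.continuousOn)
  have hKW : ∀ v ∈ K, v ∈ W ∨ v = g y ∨ v = f^[q] (g y) := by
    rintro v ((⟨t, ht, rfl⟩ | ⟨t, rfl⟩) | ⟨_, ⟨t, ht, rfl⟩, rfl⟩)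
    · exact (hseg t ht).imp_right Or.inl
    · exact Or.inl (hp t)
    · rcases hseg t ht with h | h
      · exact Or.inl (hfqW _ h)
      · exact Or.inr (Or.inr (by rw [h]))
  have hends : ∀ v, v = g y ∨ v = f^[q] (g y) → v ∉ fdrec f := by
    rintro v (rfl | rfl)
    · exact hyF
    · rwa [iterate_mem_fdrec_iff]
  have hnp : ∀ n, 0 < n → f^[n] (g y) ≠ g y := fun n hn h =>
    hyF (mem_fdrec_of_iterate_eq f hyfix hn h)
  have hfree : Disjoint K (f '' K) := by
    rw [Set.disjoint_left]
    rintro _ hv ⟨v, hvK, rfl⟩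
    rcases hKW _ hvK with h | h <;> rcases hKW _ hv with h' | h'
    · exact hd.le_bot ⟨h', v, h, rfl⟩
    · exact hends _ h' ((apply_mem_fdrec_iff f).2 (hWF h))
    · exact hends _ h ((apply_mem_fdrec_iff f).1 (hWF h'))
    · rcases h with rfl | rfl <;> rcases h' with h' | h'
      · exact hyfix h'
      · obtain ⟨m, rfl⟩ : ∃ m, q = m + 1 := ⟨q - 1, by omega⟩
        rw [Function.iterate_succ_apply'] at h'
        exact hnp m (by omega) (f.injective h').symm
      · rw [← Function.iterate_succ_apply' f q] at h'
        exact hnp (q + 1) (by omega) h'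
      · rw [← Function.iterate_succ_apply' f q, Function.iterate_succ_apply] at h'
        exact hyfix ((f.injective.iterate q) h')
  obtain ⟨D, hD, hD', haD, hbD, hDf⟩ := exists_free_disk f hKc hKp hfree
    (Or.inl (Or.inl hyγ)) (Or.inr (mem_image_of_mem _ hyγ))
  exact hyF ⟨q, hq, D, hD, hD', haD, hbD, hDf⟩

/-- **Properties of free disk recurrence.** (i) `fdrec f` is open and invariant;
(ii) it contains every non-fixed positively or negatively recurrent point;
(iii) points outside it are heteroclinic: their α- and ω-limit sets lie in connected
subsets of the fixed point set; (iv) every periodic connected component of `fdrec f`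
is fixed. -/
theorem free_disk_recurrence_properties
    (f : S2 ≃ₜ S2) (hiso : IsotopicToId ⇑f) :
    (IsOpen (fdrec ⇑f) ∧ ⇑f '' fdrec ⇑f = fdrec ⇑f) ∧
    (∀ z : S2, f z ≠ z → (z ∈ omegaSet ⇑f z ∨ z ∈ alphaSet f z) → z ∈ fdrec ⇑f) ∧
    (∀ z : S2, z ∉ fdrec ⇑f →
      (∃ C : Set S2, IsConnected C ∧ C ⊆ {w : S2 | f w = w} ∧ alphaSet f z ⊆ C) ∧
      (∃ C : Set S2, IsConnected C ∧ C ⊆ {w : S2 | f w = w} ∧ omegaSet ⇑f z ⊆ C)) ∧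
    (∀ z ∈ fdrec ⇑f, ∀ q : ℕ, 1 ≤ q →
      (⇑f)^[q] '' connectedComponentIn (fdrec ⇑f) z = connectedComponentIn (fdrec ⇑f) z →
      ⇑f '' connectedComponentIn (fdrec ⇑f) z = connectedComponentIn (fdrec ⇑f) z) := by
  have hsymm : ∀ w, f.symm w = w ↔ f w = w := fun w => by
    rw [f.symm_apply_eq, eq_comm]
  have hωfix : ∀ (g : S2 ≃ₜ S2) z, z ∉ fdrec g → ∀ x ∈ omegaSet g z, g x = x := by
    intro g z hz x hx
    by_contra h
    exact hz (mem_fdrec_of_mem_omegaSet g h hx)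
  refine ⟨⟨isOpen_fdrec f, image_fdrec f⟩, ?_, fun z hz => ⟨?_, ?_⟩, ?_⟩
  · rintro z hz (h | h)
    · exact mem_fdrec_of_mem_omegaSet f hz h
    · exact fdrec_symm_subset f (mem_fdrec_of_mem_omegaSet f.symm (mt (hsymm z).1 hz) h)
  · have h := hωfix f.symm z fun h => hz (fdrec_symm_subset f h)
    exact ⟨_, omegaSet_isConnected f.symm h, fun x hx => (hsymm x).1 (h x hx), subset_rfl⟩
  · have h := hωfix f z hz
    exact ⟨_, omegaSet_isConnected f h, h, subset_rfl⟩
  · intro z hz q hq hfq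
    have : LocallyConnectedSpace S2 := ChartedSpace.locallyConnectedSpace R2 S2
    set W := connectedComponentIn (fdrec f) z with hW
    have hWo : IsOpen W := (isOpen_fdrec f).connectedComponentIn
    have hfW : f '' W = connectedComponentIn (fdrec f) (f z) := by
      rw [hW, f.image_connectedComponentIn hz, image_fdrec]
    by_contra hne
    have hd : Disjoint W (f '' W) := by
      rw [hfW] at hne ⊢
      refine Set.disjoint_left.2 fun x hx hx' => hne ?_
      rw [connectedComponentIn_eq hx', ← connectedComponentIn_eq hx]
    have hq1 : 1 < q := by
      refine lt_of_le_of_ne hq ?_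
      rintro rfl
      exact hne (by simpa using hfq)
    have hWc : IsConnected W := isConnected_connectedComponentIn_iff.2 hz
    have hfr : ∀ x ∈ frontier W, x ∉ fdrec f := by
      intro x hx hxF
      obtain ⟨y, hy, hyW⟩ := mem_closure_iff.1 hx.1 _
        (isOpen_fdrec f).connectedComponentIn (mem_connectedComponentIn hxF)
      have hxW : x ∈ W := by
        rw [hW, connectedComponentIn_eq hyW, ← connectedComponentIn_eq hy]
        exact mem_connectedComponentIn hxF
      exact (disjoint_frontier_iff_isOpen.2 hWo).le_bot ⟨hx, hxW⟩
    exact hiso.not_disjoint_image_of_frontier_fixed hWc.nonempty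
      (frontier_fixed_of_disjoint_image f hWo hWc (connectedComponentIn_subset _ _) hfr hd hq1 hfq)
      hd
end
end

section
/- Let (X, ℬ, μ) be a probability space and T : X → X an ergodic measure-preserving automorphism (invertible with measurable inverse). Let φ : X → ℝ be integrable with ∫ φ dμ = 0. Then for every B ∈ ℬ and every ε > 0, μ({x ∈ B : ∃ n ≥ 1, Tⁿ(x) ∈ B and 0 ≤ Σ_{k=0}^{n−1} φ(T^k(x)) < ε}) = μ(B). (This strengthens Atkinson's lemma: the ergodic sum at the return time can be required to be nonnegative and less than ε, not merely of absolute value less than ε.) -/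
open MeasureTheory Filter Set
open scoped Topology ENNReal

section MeanErgodic

variable {X : Type*} [MeasurableSpace X] {μ : Measure X} {T : X → X} {g φ : X → ℝ}

theorem MeasureTheory.MeasurePreserving.aestronglyMeasurable_birkhoffSum
    (hT : MeasurePreserving T μ μ) (hg : AEStronglyMeasurable g μ) (n : ℕ) :
    AEStronglyMeasurable (birkhoffSum T g n) μ :=
  Finset.aestronglyMeasurable_fun_sum _ fun k _ ↦
    hg.comp_measurePreserving (hT.iterate k)

theorem MeasureTheory.MeasurePreserving.aestronglyMeasurable_birkhoffAverage
    (hT : MeasurePreserving T μ μ) (hg : AEStronglyMeasurable g μ) (n : ℕ) :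
    AEStronglyMeasurable (birkhoffAverage ℝ T g n) μ :=
  (hT.aestronglyMeasurable_birkhoffSum hg n).const_smul (n : ℝ)⁻¹

/-- Birkhoff averages are contractions in the `L¹` seminorm. -/
theorem MeasureTheory.MeasurePreserving.eLpNorm_one_birkhoffAverage_le
    (hT : MeasurePreserving T μ μ) (hg : AEStronglyMeasurable g μ) (n : ℕ) :
    eLpNorm (birkhoffAverage ℝ T g n) 1 μ ≤ eLpNorm g 1 μ := by
  rcases Nat.eq_zero_or_pos n with rfl | hn
  · simp
  have hsum : eLpNorm (birkhoffSum T g n) 1 μ ≤ n * eLpNorm g 1 μ := by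
    have h : birkhoffSum T g n = ∑ k ∈ Finset.range n, g ∘ T^[k] := by
      ext x; simp [birkhoffSum]
    rw [h]
    refine (eLpNorm_sum_le (fun k _ ↦ hg.comp_measurePreserving (hT.iterate k)) le_rfl).trans ?_
    simp [eLpNorm_comp_measurePreserving hg (hT.iterate _)]
  calc eLpNorm (birkhoffAverage ℝ T g n) 1 μ
      ≤ ‖(n : ℝ)⁻¹‖ₑ * eLpNorm (birkhoffSum T g n) 1 μ :=
        eLpNorm_const_smul_le (c := (n : ℝ)⁻¹) (f := birkhoffSum T g n)
    _ ≤ ‖(n : ℝ)⁻¹‖ₑ * (n * eLpNorm g 1 μ) := by gcongr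
    _ = eLpNorm g 1 μ := by
        have h0 : (n : ℝ) ≠ 0 := by positivity
        rw [enorm_inv h0, ← mul_assoc, Real.enorm_natCast, ENNReal.inv_mul_cancel, one_mul]
        · exact_mod_cast hn.ne'
        · simp

/-- The Birkhoff sums of the Koopman operator on `L²` are the pointwise Birkhoff sums. -/
theorem MeasureTheory.MeasurePreserving.coeFn_birkhoffSum_compMeasurePreserving
    (hT : MeasurePreserving T μ μ) (hg : MemLp g 2 μ) (n : ℕ) :
    ((birkhoffSum (Lp.compMeasurePreserving (E := ℝ) (p := 2) T hT) id n (hg.toLp g) :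
      Lp ℝ 2 μ) : X → ℝ) =ᵐ[μ] birkhoffSum T g n := by
  have hiter (k : ℕ) : (Lp.compMeasurePreserving (E := ℝ) (p := 2) T hT)^[k] (hg.toLp g)
      = (hg.comp_measurePreserving (hT.iterate k)).toLp (g ∘ T^[k]) := by
    induction k with
    | zero => rfl
    | succ k ih => rw [Function.iterate_succ_apply', ih]; rfl
  induction n with
  | zero => simpa using Lp.coeFn_zero ℝ 2 μ
  | succ n ih =>
    rw [birkhoffSum_succ]
    filter_upwards [ih, Lp.coeFn_add (birkhoffSum
      (Lp.compMeasurePreserving (E := ℝ) (p := 2) T hT) id n (hg.toLp g))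
      ((hg.comp_measurePreserving (hT.iterate n)).toLp (g ∘ T^[n])),
      (hg.comp_measurePreserving (hT.iterate n)).coeFn_toLp] with x h1 h2 h3
    rw [id, hiter, h2, birkhoffSum_succ, Pi.add_apply, h1, h3, Function.comp_apply]

/-- **Mean ergodic theorem** in `L²` for functions of zero mean. -/
theorem Ergodic.tendsto_eLpNorm_two_birkhoffAverage [IsProbabilityMeasure μ]
    (hT : Ergodic T μ) (hg : MemLp g 2 μ) (hmean : ∫ x, g x ∂μ = 0) :
    Tendsto (fun n ↦ eLpNorm (birkhoffAverage ℝ T g n) 2 μ) atTop (𝓝 0) := by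
  have hTm := hT.toMeasurePreserving
  let U : Lp ℝ 2 μ →L[ℝ] Lp ℝ 2 μ :=
    (Lp.compMeasurePreservingₗᵢ ℝ T hTm).toContinuousLinearMap
  let K := U.eqLocus (1 : Lp ℝ 2 μ →L[ℝ] Lp ℝ 2 μ)
  let f : Lp ℝ 2 μ := hg.toLp g
  have hone : MemLp (fun _ : X ↦ (1 : ℝ)) 2 μ := memLp_const 1
  have hproj : K.starProjection f = 0 := by
    have hfix : U (K.starProjection f) = K.starProjection f :=
      (K.starProjection_apply_mem f :)
    obtain ⟨c, hc⟩ := hT.ae_eq_const_of_ae_eq_comp_ae (Lp.aestronglyMeasurable (K.starProjection f))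
      ((Lp.coeFn_compMeasurePreserving (K.starProjection f) hTm).symm.trans
        (.of_eq (congrArg (fun h : Lp ℝ 2 μ ↦ (h : X → ℝ)) hfix)))
    have horth := K.starProjection_inner_eq_zero f (hone.toLp _) (show U _ = _ from rfl)
    rw [L2.inner_def] at horth
    have h_integral : ∫ x, (g x - c) ∂μ = 0 := by
      rw [← horth]
      refine integral_congr_ae ?_
      filter_upwards [hc, Lp.coeFn_sub f (K.starProjection f), (hg.coeFn_toLp : f =ᵐ[μ] g),
        hone.coeFn_toLp]
        with x h1 h2 h3 h4
      rw [h2, h4, Pi.sub_apply, h1, h3]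
      simp
    have hc0 : c = 0 := by
      rw [integral_sub (hg.integrable one_le_two) (integrable_const c), hmean] at h_integral
      simpa using h_integral
    refine Lp.ext (hc.trans ?_)
    filter_upwards [Lp.coeFn_zero ℝ 2 μ] with x hx
    rw [hx]
    simp [hc0]
  have hlim := U.tendsto_birkhoffAverage_orthogonalProjection
    (LinearIsometry.norm_toContinuousLinearMap_le _) f
  rw [← Submodule.starProjection_apply] at hlim
  change Tendsto _ _ (𝓝 (K.starProjection f)) at hlim
  rw [hproj, Lp.tendsto_Lp_iff_tendsto_eLpNorm'] at hlim
  refine hlim.congr fun n ↦ eLpNorm_congr_ae ?_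
  filter_upwards [Lp.coeFn_sub (birkhoffAverage ℝ U id n f) 0, Lp.coeFn_zero ℝ 2 μ,
    Lp.coeFn_smul (n : ℝ)⁻¹ (birkhoffSum U id n f),
    hTm.coeFn_birkhoffSum_compMeasurePreserving hg n] with x h1 h2 h3 h4
  rw [Pi.sub_apply, h2, Pi.zero_apply, sub_zero, birkhoffAverage, h3, birkhoffAverage,
    Pi.smul_apply]
  exact congrArg _ h4

/-- **Mean ergodic theorem** in `L¹` for functions of zero mean. -/
theorem Ergodic.tendsto_eLpNorm_one_birkhoffAverage [IsProbabilityMeasure μ]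
    (hT : Ergodic T μ) (hφ : Integrable φ μ) (hmean : ∫ x, φ x ∂μ = 0) :
    Tendsto (fun n ↦ eLpNorm (birkhoffAverage ℝ T φ n) 1 μ) atTop (𝓝 0) := by
  have hTm := hT.toMeasurePreserving
  rw [ENNReal.tendsto_nhds_zero]
  intro ε hε
  have hε3 : ε / 3 ≠ 0 := (ENNReal.div_pos hε.ne' (by simp)).ne'
  obtain ⟨g, hg, hg1⟩ :=
    (memLp_one_iff_integrable.2 hφ).exists_simpleFunc_eLpNorm_sub_lt ENNReal.one_ne_top hε3
  have hgint : Integrable g μ := memLp_one_iff_integrable.1 hg1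
  set c := ∫ x, g x ∂μ with hc
  have hg2 : MemLp (fun x ↦ g x - c) 2 μ :=
    ((g.memLp_top μ).mono_exponent le_top).sub (memLp_const c)
  have hcnorm : ‖c‖ₑ ≤ ε / 3 := by
    have : c = - ∫ x, (φ - ⇑g) x ∂μ := by
      simp [integral_sub hφ hgint, hmean, hc]
    rw [this, enorm_neg]
    refine (enorm_integral_le_lintegral_enorm _).trans ?_
    rw [← eLpNorm_one_eq_lintegral_enorm]
    exact hg.le
  have hrest : eLpNorm (φ - fun x ↦ g x - c) 1 μ ≤ ε / 3 + ε / 3 := by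
    have : (φ - fun x ↦ g x - c) = (φ - ⇑g) + fun _ ↦ c := by
      ext x; simp; ring
    rw [this]
    refine (eLpNorm_add_le (hφ.sub hgint).1 aestronglyMeasurable_const le_rfl).trans ?_
    refine add_le_add hg.le ?_
    simpa [eLpNorm_one_eq_lintegral_enorm] using hcnorm
  have hlim := hT.tendsto_eLpNorm_two_birkhoffAverage hg2 (by
    rw [integral_sub hgint (integrable_const c)]; simp [hc])
  filter_upwards [ENNReal.tendsto_nhds_zero.1 hlim (ε / 3) hε3.bot_lt] with n hn
  have hsplit : birkhoffAverage ℝ T φ n =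
      birkhoffAverage ℝ T (fun x ↦ g x - c) n + birkhoffAverage ℝ T (φ - fun x ↦ g x - c) n := by
    rw [birkhoffAverage_sub]; simp
  rw [hsplit]
  have hrest_meas := hφ.1.sub hg2.1
  calc _ ≤ eLpNorm (birkhoffAverage ℝ T (fun x ↦ g x - c) n) 1 μ +
        eLpNorm (birkhoffAverage ℝ T (φ - fun x ↦ g x - c) n) 1 μ :=
        eLpNorm_add_le (hTm.aestronglyMeasurable_birkhoffAverage hg2.1 n)
          (hTm.aestronglyMeasurable_birkhoffAverage hrest_meas n) le_rfl
    _ ≤ ε / 3 + (ε / 3 + ε / 3) := by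
        refine add_le_add ?_ ((hTm.eLpNorm_one_birkhoffAverage_le hrest_meas n).trans hrest)
        exact (eLpNorm_le_eLpNorm_of_exponent_le one_le_two
          (hTm.aestronglyMeasurable_birkhoffAverage hg2.1 n)).trans hn
    _ = ε := by rw [← add_assoc, ENNReal.add_thirds]

end MeanErgodic

section SkewProduct

variable {X : Type*} {T : X → X} {φ : X → ℝ}

/-- The skew product over `T` with real fibres and cocycle `φ`. -/
def realSkewProduct (T : X → X) (φ : X → ℝ) (p : X × ℝ) : X × ℝ :=
  (T p.1, p.2 + φ p.1)

theorem iterate_realSkewProduct (n : ℕ) (p : X × ℝ) :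
    (realSkewProduct T φ)^[n] p = (T^[n] p.1, p.2 + birkhoffSum T φ n p.1) := by
  induction n with
  | zero => simp
  | succ n ih =>
    rw [Function.iterate_succ_apply', ih, Function.iterate_succ_apply', birkhoffSum_succ,
      realSkewProduct, add_assoc]

variable [MeasurableSpace X] {μ : Measure X}

theorem measurable_birkhoffSum_real (hT : Measurable T) (hφ : Measurable φ) (n : ℕ) :
    Measurable (birkhoffSum T φ n) :=
  Finset.measurable_fun_sum _ fun k _ ↦ hφ.comp (hT.iterate k)

theorem MeasureTheory.MeasurePreserving.realSkewProduct [SFinite μ]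
    (hT : MeasurePreserving T μ μ) (hφ : Measurable φ) :
    MeasurePreserving (realSkewProduct T φ) (μ.prod volume) (μ.prod volume) :=
  hT.skew_product (g := fun x t ↦ t + φ x)
    (measurable_snd.add (hφ.comp measurable_fst))
    (.of_forall fun x ↦ map_add_right_eq_self volume (φ x))

/-- If a bounded set `s` is disjoint from all its iterated preimages under the skew product, then
its measure is controlled by the deviations of the Birkhoff sums: the part of the preimages which
leaves a large strip lies over points with a large Birkhoff sum. -/
theorem nat_mul_measureReal_le_of_wandering [IsProbabilityMeasure μ]
    (hT : MeasurePreserving T μ μ) (hφ : Measurable φ) {s : Set (X × ℝ)} (hs : MeasurableSet s)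
    {M : ℝ} (hM : 0 ≤ M) (hsM : ∀ p ∈ s, |p.2| ≤ M)
    (hwand : ∀ p ∈ s, ∀ m ≠ 0, (realSkewProduct T φ)^[m] p ∉ s)
    {δ : ℝ} (hδ : 0 ≤ δ) (N : ℕ) :
    N * (μ.prod volume).real s ≤ 2 * (M + δ * N) +
      2 * M * ∑ n ∈ Finset.range N, μ.real {x | δ * n ≤ |birkhoffSum T φ n x|} := by
  set F := realSkewProduct T φ with hF
  set ν : Measure (X × ℝ) := μ.prod volume with hν
  have hFm : MeasurePreserving F ν ν := hT.realSkewProduct hφ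
  set R := M + δ * N with hR
  have hR0 : 0 ≤ R := by positivity
  set Z : Set (X × ℝ) := univ ×ˢ Icc (-R) R with hZ
  have hZν : ν Z = ENNReal.ofReal (2 * R) := by
    simp [hZ, hν, Measure.prod_prod, two_mul]
  have hsZ : s ⊆ univ ×ˢ Icc (-M) M := fun p hp ↦ ⟨mem_univ _, abs_le.1 (hsM p hp)⟩
  have hsν : ν s ≠ ⊤ := by
    refine measure_ne_top_of_subset hsZ ?_
    simp [hν, Measure.prod_prod]
  have hZm : MeasurableSet Z := MeasurableSet.univ.prod measurableSet_Icc
  have hpre (n : ℕ) : MeasurableSet (F^[n] ⁻¹' s) := (hFm.iterate n).measurable hs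
  have hpreν (n : ℕ) : ν (F^[n] ⁻¹' s) = ν s :=
    (hFm.iterate n).measure_preimage hs.nullMeasurableSet
  have hdisj_lt (i j : ℕ) (hij : i < j) : Disjoint (F^[i] ⁻¹' s) (F^[j] ⁻¹' s) := by
    refine Set.disjoint_left.2 fun p hi hj ↦ hwand _ hi (j - i) (by omega) ?_
    rw [← Function.iterate_add_apply, Nat.sub_add_cancel hij.le]
    exact hj
  have hdisj : Pairwise (Function.onFun Disjoint fun n ↦ F^[n] ⁻¹' s ∩ Z) := by
    intro i j hij
    refine Disjoint.mono inter_subset_left inter_subset_left ?_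
    rcases hij.lt_or_gt with h | h
    · exact hdisj_lt i j h
    · exact (hdisj_lt j i h).symm
  have hin : ∑ n ∈ Finset.range N, ν.real (F^[n] ⁻¹' s ∩ Z) ≤ 2 * R := by
    rw [← measureReal_biUnion_finset (fun i _ j _ hij ↦ hdisj hij)
      (fun n _ ↦ (hpre n).inter hZm)
      (fun n _ ↦ measure_ne_top_of_subset inter_subset_left (by rwa [hpreν]))]
    calc _ ≤ ν.real Z := measureReal_mono (iUnion₂_subset fun _ _ ↦ inter_subset_right)
            (hZν ▸ ENNReal.ofReal_ne_top)
      _ = 2 * R := by rw [measureReal_def, hZν, ENNReal.toReal_ofReal (by positivity)]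
  have hout (n : ℕ) (hn : n < N) : ν.real (F^[n] ⁻¹' s \ Z) ≤
      2 * M * μ.real {x | δ * n ≤ |birkhoffSum T φ n x|} := by
    set A := {x | δ * n ≤ |birkhoffSum T φ n x|} with hA
    have hAm : MeasurableSet A :=
      measurableSet_le measurable_const
        (measurable_birkhoffSum_real hT.measurable hφ n).abs
    have hsec (x : X) : volume (Prod.mk x ⁻¹' (F^[n] ⁻¹' s \ Z)) ≤
        A.indicator (fun _ ↦ ENNReal.ofReal (2 * M)) x := by
      by_cases hx : x ∈ A
      · rw [indicator_of_mem hx]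
        calc _ ≤ volume (Icc (-M - birkhoffSum T φ n x) (M - birkhoffSum T φ n x)) := by
              refine measure_mono fun t ht ↦ ?_
              have h := abs_le.1 (hsM _ ht.1)
              rw [hF, iterate_realSkewProduct] at h
              exact ⟨by linarith [h.1], by linarith [h.2]⟩
          _ = _ := by rw [Real.volume_Icc]; congr 1; ring
      · rw [indicator_of_notMem hx, nonpos_iff_eq_zero]
        convert measure_empty (μ := (volume : Measure ℝ))
        refine eq_empty_of_forall_notMem fun t ht ↦ ht.2 ⟨mem_univ _, abs_le.1 ?_⟩
        have h := hsM _ ht.1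
        rw [hF, iterate_realSkewProduct] at h
        have hx' : |birkhoffSum T φ n x| < δ * n := not_le.1 hx
        have hnN : δ * n ≤ δ * N := by gcongr
        have := abs_sub (t + birkhoffSum T φ n x) (birkhoffSum T φ n x)
        rw [add_sub_cancel_right] at this
        linarith
    have hle : ν (F^[n] ⁻¹' s \ Z) ≤ ENNReal.ofReal (2 * M) * μ A := by
      rw [hν, Measure.prod_apply ((hpre n).diff hZm)]
      refine (lintegral_mono hsec).trans_eq ?_
      rw [lintegral_indicator_const hAm]
    have := ENNReal.toReal_mono (ENNReal.mul_ne_top ENNReal.ofReal_ne_top (measure_ne_top _ _)) hle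
    rwa [ENNReal.toReal_mul, ENNReal.toReal_ofReal (by positivity)] at this
  calc N * ν.real s = ∑ n ∈ Finset.range N, ν.real (F^[n] ⁻¹' s) := by
        simp [measureReal_def, hpreν]
    _ = ∑ n ∈ Finset.range N, ν.real (F^[n] ⁻¹' s ∩ Z) +
        ∑ n ∈ Finset.range N, ν.real (F^[n] ⁻¹' s \ Z) := by
        rw [← Finset.sum_add_distrib]
        refine Finset.sum_congr rfl fun n _ ↦ ?_
        rw [measureReal_inter_add_sdiff hZm (by rwa [hpreν])]
    _ ≤ 2 * R + ∑ n ∈ Finset.range N,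
        2 * M * μ.real {x | δ * n ≤ |birkhoffSum T φ n x|} :=
        add_le_add hin (Finset.sum_le_sum fun n hn ↦ hout n (Finset.mem_range.1 hn))
    _ = _ := by rw [Finset.mul_sum]

/-- The Birkhoff sums of an integrable function of zero mean are sublinear in measure. -/
theorem Ergodic.tendsto_measureReal_birkhoffSum_ge [IsProbabilityMeasure μ]
    (hT : Ergodic T μ) (hφ : Integrable φ μ) (hmean : ∫ x, φ x ∂μ = 0) {δ : ℝ} (hδ : 0 < δ) :
    Tendsto (fun n : ℕ ↦ μ.real {x | δ * n ≤ |birkhoffSum T φ n x|}) atTop (𝓝 0) := by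
  have hmeas : TendstoInMeasure μ (birkhoffAverage ℝ T φ) atTop 0 :=
    tendstoInMeasure_of_tendsto_eLpNorm one_ne_zero
      (hT.toMeasurePreserving.aestronglyMeasurable_birkhoffAverage hφ.1)
      aestronglyMeasurable_zero
      (by simpa only [sub_zero] using hT.tendsto_eLpNorm_one_birkhoffAverage hφ hmean)
  refine (tendstoInMeasure_iff_measureReal_norm.1 hmeas δ hδ).congr' ?_
  filter_upwards [eventually_gt_atTop 0] with n hn
  have hn' : (0 : ℝ) < n := by exact_mod_cast hn
  have habs (x : X) : ‖birkhoffAverage ℝ T φ n x - (0 : X → ℝ) x‖ =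
      (n : ℝ)⁻¹ * |birkhoffSum T φ n x| := by
    simp [birkhoffAverage]
  simp only [habs, le_inv_mul_iff₀ hn', mul_comm δ]

/-- **Atkinson's theorem**: over an ergodic probability-preserving map, the skew product with an
integrable cocycle of zero mean is conservative. -/
theorem Ergodic.conservative_realSkewProduct [IsProbabilityMeasure μ]
    (hT : Ergodic T μ) (hφm : Measurable φ) (hφ : Integrable φ μ) (hmean : ∫ x, φ x ∂μ = 0) :
    Conservative (realSkewProduct T φ) (μ.prod volume) where
  toQuasiMeasurePreserving := (hT.toMeasurePreserving.realSkewProduct hφm).quasiMeasurePreserving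
  exists_mem_iterate_mem' := by
    intro s hs hs0
    by_contra! hwand
    obtain ⟨M, hM⟩ : ∃ M : ℕ, (μ.prod volume) (s ∩ univ ×ˢ Icc (-M : ℝ) M) ≠ 0 := by
      by_contra! h
      refine hs0 (measure_mono_null (fun p hp ↦ ?_) (measure_iUnion_null h))
      obtain ⟨M, hM⟩ := exists_nat_ge |p.2|
      exact mem_iUnion.2 ⟨M, hp, mem_univ _, abs_le.1 hM⟩
    set s' : Set (X × ℝ) := s ∩ univ ×ˢ Icc (-M : ℝ) M with hs'
    have hs'm : MeasurableSet s' := hs.inter (MeasurableSet.univ.prod measurableSet_Icc)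
    have hs'top : (μ.prod volume) s' ≠ ⊤ :=
      measure_ne_top_of_subset inter_subset_right (by simp [Measure.prod_prod])
    have hdev (δ : ℝ) (hδ : 0 < δ) := hT.tendsto_measureReal_birkhoffSum_ge hφ hmean hδ
    have hsmall (δ : ℝ) (hδ : 0 < δ) : (μ.prod volume).real s' ≤ 2 * δ := by
      have hlim : Tendsto (fun N : ℕ ↦ 2 * (M * (N : ℝ)⁻¹ + δ) + 2 * M * ((N : ℝ)⁻¹ *
          ∑ n ∈ Finset.range N, μ.real {x | δ * n ≤ |birkhoffSum T φ n x|})) atTop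
          (𝓝 (2 * (M * 0 + δ) + 2 * M * 0)) :=
        (((tendsto_inv_atTop_nhds_zero_nat.const_mul _).add_const _).const_mul _).add
          ((hdev δ hδ).cesaro.const_mul _)
      rw [mul_zero, mul_zero, zero_add, add_zero] at hlim
      refine ge_of_tendsto hlim ?_
      filter_upwards [eventually_gt_atTop 0] with N hN
      have hN' : (0 : ℝ) < N := by exact_mod_cast hN
      have h := nat_mul_measureReal_le_of_wandering hT.toMeasurePreserving hφm hs'm
        M.cast_nonneg (fun p hp ↦ abs_le.2 hp.2.2)
        (fun p hp m hm hmem ↦ hwand p hp.1 m hm hmem.1) hδ.le N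
      rw [← le_inv_mul_iff₀ hN'] at h
      refine h.trans_eq ?_
      field_simp
    have hzero : (μ.prod volume).real s' ≤ 0 :=
      le_of_forall_pos_le_add fun η hη ↦ by linarith [hsmall (η / 2) (by positivity)]
    exact hM ((measureReal_eq_zero_iff hs'top).1 (hzero.antisymm measureReal_nonneg))

/-- Almost every point of `B` returns to `B` with Birkhoff sum in `[0, ε)`, provided the skew
product is conservative. The fibre coordinates of successive returns of a bad point would be
strictly decreasing, which contradicts recurrence to a strip with a rational lower end. -/
theorem MeasureTheory.Conservative.ae_exists_birkhoffSum_mem_Ico [SFinite μ]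
    (hcons : Conservative (realSkewProduct T φ) (μ.prod volume))
    (hT : Measurable T) (hφ : Measurable φ) {B : Set X} (hB : MeasurableSet B)
    {ε : ℝ} (hε : 0 < ε) :
    ∀ᵐ x ∂μ, x ∈ B → ∃ n, 1 ≤ n ∧ T^[n] x ∈ B ∧ birkhoffSum T φ n x ∈ Ico 0 ε := by
  set C := {x | x ∈ B ∧ ∀ n, 1 ≤ n → T^[n] x ∈ B → birkhoffSum T φ n x ∉ Ico 0 ε} with hC
  have hCm : MeasurableSet C := by
    refine hB.inter (?_ :
      MeasurableSet {x | ∀ n, 1 ≤ n → T^[n] x ∈ B → birkhoffSum T φ n x ∉ Ico 0 ε})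
    simp only [ofPred_forall]
    refine .iInter fun n ↦ .iInter fun _ ↦ ?_
    simp only [imp_iff_not_or, ofPred_or]
    exact (hT.iterate n hB).compl.union
      (measurable_birkhoffSum_real hT hφ n measurableSet_Ico).compl
  suffices hC0 : μ C = 0 by
    filter_upwards [measure_eq_zero_iff_ae_notMem.1 hC0] with x hx hxB
    by_contra! h
    exact hx ⟨hxB, h⟩
  by_contra hC0
  have hrec : ∀ᵐ p ∂μ.prod volume, ∀ q : ℚ, p ∈ C ×ˢ Ico (q : ℝ) ε →
      ∃ᶠ n in atTop, (realSkewProduct T φ)^[n] p ∈ C ×ˢ Ico (q : ℝ) ε :=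
    ae_all_iff.2 fun q ↦
      hcons.ae_mem_imp_frequently_image_mem (hCm.prod measurableSet_Ico).nullMeasurableSet
  have hpos : (μ.prod volume) (C ×ˢ Ico 0 ε) ≠ 0 := by
    simp [Measure.prod_prod, hC0, hε]
  obtain ⟨⟨x, t⟩, ⟨hxC, ht0, htε⟩, hp⟩ :=
    (frequently_ae_mem_iff.2 hpos).and_eventually hrec |>.exists
  simp only [iterate_realSkewProduct, mem_prod, mem_Ico, and_imp, frequently_atTop]
    at hp ht0 htε hxC
  obtain ⟨n, hn, hnC, hn0, hnε⟩ := hp 0 hxC (by simpa using ht0) htε 1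
  have hlt : t + birkhoffSum T φ n x < t := by
    by_contra! h
    exact hxC.2 n hn hnC.1 ⟨by linarith, by linarith [Rat.cast_zero (α := ℝ)]⟩
  obtain ⟨q, hq1, hq2⟩ := exists_rat_btwn hlt
  obtain ⟨m, hm, hmC, hm0, hmε⟩ := hp q hxC hq2.le htε (n + 1)
  obtain ⟨k, rfl⟩ := Nat.exists_eq_add_of_le (show n ≤ m by omega)
  rw [birkhoffSum_add] at hm0 hmε
  rw [add_comm n k, Function.iterate_add_apply] at hmC
  rw [Rat.cast_zero] at hn0
  exact hnC.2 k (by omega) hmC.1 ⟨by linarith, by linarith⟩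

end SkewProduct

/-- **Improved Atkinson lemma.** Let `T` be an ergodic measure-preserving automorphism of
a probability space and `φ` an integrable function with zero mean. Then for every
measurable set `B` and every `ε > 0`, almost every point of `B` returns to `B` at a time
`n ≥ 1` at which the ergodic sum of `φ` lies in `[0, ε)`. -/
theorem improved_atkinson
    {X : Type*} [MeasurableSpace X] (μ : Measure X) [IsProbabilityMeasure μ]
    (T : X → X) (hT : Ergodic T μ)
    (Tinv : X → X) (hTinvMeas : Measurable Tinv)
    (hleft : Function.LeftInverse Tinv T) (hright : Function.RightInverse Tinv T)
    (φ : X → ℝ) (hφint : Integrable φ μ) (hφmean : (∫ x, φ x ∂μ) = 0) :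
    ∀ B : Set X, MeasurableSet B → ∀ ε : ℝ, 0 < ε →
      μ {x | x ∈ B ∧ ∃ n : ℕ, 1 ≤ n ∧ T^[n] x ∈ B ∧
        0 ≤ ∑ k ∈ Finset.range n, φ (T^[k] x) ∧
        ∑ k ∈ Finset.range n, φ (T^[k] x) < ε} = μ B := by
  intro B hB ε hε
  obtain ⟨ψ, hψm, hψ⟩ := hφint.1.aemeasurable
  have hψmean : ∫ x, ψ x ∂μ = 0 := (integral_congr_ae hψ).symm.trans hφmean
  have hcons := hT.conservative_realSkewProduct hψm (hφint.congr hψ) hψmean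
  have hsum : ∀ᵐ x ∂μ, ∀ n, birkhoffSum T φ n x = birkhoffSum T ψ n x :=
    ae_all_iff.2 (hT.quasiMeasurePreserving.birkhoffSum_ae_eq_of_ae_eq hψ)
  refine measure_congr (eventuallyEq_set.2 ?_)
  filter_upwards [hcons.ae_exists_birkhoffSum_mem_Ico hT.measurable hψm hB hε, hsum] with x hx hxs
  refine ⟨fun h ↦ h.1, fun hxB ↦ ⟨hxB, ?_⟩⟩
  obtain ⟨n, hn, hnB, hnε⟩ := hx hxB
  rw [← hxs] at hnε
  exact ⟨n, hn, hnB, hnε⟩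
end
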